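/- For every real α ≥ 2, the function f satisfies the functional equation f(α) = 1 / ( 1 + (1 − 2/α)/f(α−1) ). -/

import Mathlib

/-- The function `f : [1,∞) → ℝ` with `f(1) = 1` and, for `α > 1`,
`f(α) = α(α−1) / ( k·( α(α−k) + (k−1)(k+1)/3 ) )` where `k = ⌊α⌋`. -/
noncomputable def f (α : ℝ) : ℝ :=
  if α = 1 then 1
  else α * (α - 1) /
    ((⌊α⌋ : ℝ) * (α * (α - (⌊α⌋ : ℝ)) + ((⌊α⌋ : ℝ) - 1) * ((⌊α⌋ : ℝ) + 1) / 3))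

theorem stmt_11 (α : ℝ) (hα : 2 ≤ α) :
    f α = 1 / (1 + (1 - 2 / α) / f (α - 1)) := by
  rcases hα.eq_or_lt with rfl | hα
  · norm_num [f]
  have h0 : α ≠ 0 := by linarith
  have h1 : α - 1 ≠ 0 := by linarith
  have h2 : α - 2 ≠ 0 := by linarith
  have hα1 : α ≠ 1 := by linarith
  have hβ1 : α - 1 ≠ 1 := fun h => h2 (by linarith)
  rw [f, f, if_neg hα1, if_neg hβ1, Int.floor_sub_one]
  push_cast
  generalize (⌊α⌋ : ℝ) = k
  rw [← inv_div, one_div, div_eq_mul_inv (1 - 2 / α), inv_div, sub_sub α 1 1, one_add_one_eq_two]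
  field_simp
  ring
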